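/- Fix μ₁, μ₂ ∈ ℝ and σ₁, σ₂ > 0 with (μ₁, σ₁) ≠ (μ₂, σ₂). Define, for κ ≥ 0, BC(κ) = exp( −¼·ln( ¼·( (σ₁² + κ)/(σ₂² + κ) + (σ₂² + κ)/(σ₁² + κ) + 2 ) ) − ¼·(μ₁ − μ₂)²/(σ₁² + σ₂² + 2κ) ). Then BC is strictly increasing on [0, ∞), and BC(κ) → 1 as κ → ∞. -/

import Mathlib

open Filter Topology

/-- The variance-ratio term of the Bhattacharyya coefficient as `1` plus a mismatch term. -/
lemma quarter_ratio_add_inv_ratio {x y : ℝ} (hx : 0 < x) (hy : 0 < y) :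
    (1 / 4) * (x / y + y / x + 2) = 1 + (x - y) ^ 2 / (4 * (x * y)) := by
  field_simp
  ring

/-- The Bhattacharyya coefficient of `N(μ₁, σ₁²+κ)` and `N(μ₂, σ₂²+κ)`, as a
function of the regularization `κ ≥ 0`, is strictly increasing on `[0,∞)` and
tends to `1` as `κ → ∞`, provided `(μ₁, σ₁) ≠ (μ₂, σ₂)`. -/
theorem bhattacharyya_strictMono_tendsto_one (μ1 μ2 σ1 σ2 : ℝ)
    (h1 : 0 < σ1) (h2 : 0 < σ2) (hne : (μ1, σ1) ≠ (μ2, σ2))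
    (BC : ℝ → ℝ)
    (hBC : ∀ κ, BC κ = Real.exp (
      -(1 / 4) * Real.log ((1 / 4) * ((σ1 ^ 2 + κ) / (σ2 ^ 2 + κ) +
        (σ2 ^ 2 + κ) / (σ1 ^ 2 + κ) + 2)) -
      (1 / 4) * (μ1 - μ2) ^ 2 / (σ1 ^ 2 + σ2 ^ 2 + 2 * κ))) :
    StrictMonoOn BC (Set.Ici 0) ∧ Tendsto BC atTop (nhds 1) := by
  have ha : 0 < σ1 ^ 2 := by positivity
  have hb : 0 < σ2 ^ 2 := by positivity
  have hab : σ1 ^ 2 = σ2 ^ 2 → μ1 ≠ μ2 := by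
    rintro h rfl
    exact hne (by rw [(sq_eq_sq₀ h1.le h2.le).1 h])
  generalize σ1 ^ 2 = a at *
  generalize σ2 ^ 2 = b at *
  have hBC' : ∀ κ, 0 ≤ κ → BC κ = Real.exp (
      -(1 / 4) * Real.log (1 + (a - b) ^ 2 / (4 * ((a + κ) * (b + κ)))) -
      (1 / 4) * (μ1 - μ2) ^ 2 / (a + b + 2 * κ)) := by
    intro κ hκ
    rw [hBC, quarter_ratio_add_inv_ratio (by positivity) (by positivity),
      add_sub_add_right_eq_sub]
  constructor
  · intro x hx y hy hxy
    simp only [Set.mem_Ici] at hx hy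
    rw [hBC' x hx, hBC' y hy, Real.exp_lt_exp]
    have hprod : (a + x) * (b + x) < (a + y) * (b + y) := by gcongr
    have hsum : a + b + 2 * x < a + b + 2 * y := by gcongr
    by_cases h : a = b
    · subst h
      have hμ : 0 < (μ1 - μ2) ^ 2 := by
        have := sub_ne_zero.2 (hab rfl)
        positivity
      have : (1 / 4) * (μ1 - μ2) ^ 2 / (a + a + 2 * y) <
          (1 / 4) * (μ1 - μ2) ^ 2 / (a + a + 2 * x) :=
        div_lt_div_of_pos_left (by positivity) (by positivity) hsum
      simpa using this
    · have hd : 0 < (a - b) ^ 2 := by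
        have := sub_ne_zero.2 h
        positivity
      have hmean : (1 / 4) * (μ1 - μ2) ^ 2 / (a + b + 2 * y) ≤
          (1 / 4) * (μ1 - μ2) ^ 2 / (a + b + 2 * x) :=
        div_le_div_of_nonneg_left (by positivity) (by positivity) hsum.le
      have hvar : (a - b) ^ 2 / (4 * ((a + y) * (b + y))) <
          (a - b) ^ 2 / (4 * ((a + x) * (b + x))) :=
        div_lt_div_of_pos_left hd (by positivity) (by linarith)
      have hlog := Real.log_lt_log (by positivity) (add_lt_add_right hvar 1)
      linarith
  · have hadd (c : ℝ) : Tendsto (fun κ : ℝ => c + κ) atTop atTop :=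
      tendsto_atTop_add_const_left _ _ tendsto_id
    have hvar : Tendsto (fun κ => 1 + (a - b) ^ 2 / (4 * ((a + κ) * (b + κ)))) atTop (𝓝 1) := by
      simpa using (((((hadd a).atTop_mul_atTop₀ (hadd b)).const_mul_atTop
        (by norm_num : (0 : ℝ) < 4)).const_div_atTop ((a - b) ^ 2)).const_add 1)
    have hmean : Tendsto (fun κ => (1 / 4) * (μ1 - μ2) ^ 2 / (a + b + 2 * κ)) atTop (𝓝 0) :=
      (tendsto_atTop_add_const_left _ _
        (tendsto_id.const_mul_atTop (by norm_num : (0 : ℝ) < 2))).const_div_atTop _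
    have hlim := (((hvar.log one_ne_zero).const_mul (-(1 / 4))).sub hmean).rexp
    simp only [Real.log_one, mul_zero, sub_zero, Real.exp_zero] at hlim
    refine hlim.congr' ?_
    filter_upwards [eventually_ge_atTop 0] with κ hκ
    exact (hBC' κ hκ).symm
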